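/- For every τ ≥ 0, the function t ↦ 1/ĝ_τ(t) is well defined (i.e. ĝ_τ(t) > 0), positive, and convex on the interval [-τ, τ]. -/

import Mathlib

open MeasureTheory Real Set FourierTransform Filter Topology

/-- The auxiliary function `g_τ`, supported on `[-1,1]`, with
`g_τ(x) = 2(1-|x|)(cos(2πτx) - cos(2π(τ+1)x))/(4π²x²)` for `0 < |x| ≤ 1` and the
continuous extension `g_τ(0) = 2τ + 1`. -/
noncomputable def gfun (τ : ℝ) (x : ℝ) : ℝ :=
  if x = 0 then 2 * τ + 1
  else if |x| ≤ 1 then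
    2 * (1 - |x|) * (Real.cos (2 * π * τ * x) - Real.cos (2 * π * (τ + 1) * x)) /
      (4 * π ^ 2 * x ^ 2)
  else 0

/-- The Fourier transform `ĝ_τ(t) = ∫_{-1}^{1} g_τ(x) e^{-2πixt} dx`.  Since `g_τ` is
real-valued, even and supported in `[-1,1]`, this equals the real-valued cosine
integral `∫ g_τ(x) cos(2πxt) dx` over `ℝ`, which we take as the definition. -/
noncomputable def ghat (τ : ℝ) (t : ℝ) : ℝ :=
  ∫ x : ℝ, gfun τ x * Real.cos (2 * π * x * t)

/-- The Fejér kernel `(sin πa / πa)²`, as the cosine transform of `x ↦ max (1 - |x|) 0`. -/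
noncomputable def fejerKernel (a : ℝ) : ℝ :=
  ∫ x in (0 : ℝ)..1, 2 * (1 - x) * cos (2 * π * a * x)

/-- The odd antiderivative of the Fejér kernel. -/
noncomputable def fejerPrimitive (a : ℝ) : ℝ :=
  ∫ x in (0 : ℝ)..1, 2 * (1 - x) * sin (2 * π * a * x) / (2 * π * x)

/-- The even second antiderivative of the Fejér kernel that vanishes at `0`. -/
noncomputable def fejerSecondPrimitive (a : ℝ) : ℝ :=
  ∫ x in (0 : ℝ)..1, 2 * (1 - x) * (1 - cos (2 * π * a * x)) / (4 * π ^ 2 * x ^ 2)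

lemma intervalIntegrable_zero_one_of_bounded {f : ℝ → ℝ} (hf : Measurable f) (C : ℝ)
    (hC : ∀ x ∈ Ioc (0 : ℝ) 1, |f x| ≤ C) : IntervalIntegrable f volume 0 1 := by
  rw [intervalIntegrable_iff_integrableOn_Ioc_of_le zero_le_one]
  refine Measure.integrableOn_of_bounded (M := C) (by simp) hf.aestronglyMeasurable ?_
  exact (ae_restrict_iff' measurableSet_Ioc).2 (ae_of_all _ hC)

lemma abs_fejerPrimitive_integrand_le (a : ℝ) {x : ℝ} (hx : x ∈ Ioc (0 : ℝ) 1) :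
    |2 * (1 - x) * sin (2 * π * a * x) / (2 * π * x)| ≤ 2 * |a| := by
  obtain ⟨hx0, hx1⟩ := hx
  have hpos : 0 < 2 * π * x := by positivity
  have hsin : |sin (2 * π * a * x)| ≤ |a| * (2 * π * x) := by
    calc |sin (2 * π * a * x)| ≤ |2 * π * a * x| := abs_sin_le_abs
      _ = |a * (2 * π * x)| := by ring_nf
      _ = |a| * (2 * π * x) := by rw [abs_mul, abs_of_pos hpos]
  rw [abs_div, abs_mul, abs_of_pos hpos, div_le_iff₀ hpos, abs_of_nonneg (by linarith)]
  calc 2 * (1 - x) * |sin (2 * π * a * x)| ≤ 2 * (|a| * (2 * π * x)) := by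
        gcongr
        linarith
    _ = 2 * |a| * (2 * π * x) := by ring

lemma fejerSecondPrimitive_integrand_intervalIntegrable (a : ℝ) :
    IntervalIntegrable
      (fun x ↦ 2 * (1 - x) * (1 - cos (2 * π * a * x)) / (4 * π ^ 2 * x ^ 2)) volume 0 1 := by
  refine intervalIntegrable_zero_one_of_bounded (by fun_prop) (a ^ 2) fun x ⟨hx0, hx1⟩ ↦ ?_
  have hcos := one_sub_sq_div_two_le_cos (x := 2 * π * a * x)
  have hcos' := cos_le_one (2 * π * a * x)
  have hpos : 0 < 4 * π ^ 2 * x ^ 2 := by positivity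
  rw [abs_of_nonneg (div_nonneg (mul_nonneg (by linarith) (by linarith)) hpos.le),
    div_le_iff₀ hpos]
  calc 2 * (1 - x) * (1 - cos (2 * π * a * x)) ≤ 2 * ((2 * π * a * x) ^ 2 / 2) := by
        gcongr
        all_goals linarith
    _ = a ^ 2 * (4 * π ^ 2 * x ^ 2) := by ring

lemma hasDerivAt_fejerSecondPrimitive (a : ℝ) :
    HasDerivAt fejerSecondPrimitive (fejerPrimitive a) a := by
  refine (intervalIntegral.hasDerivAt_integral_of_dominated_loc_of_deriv_le
    (F := fun a x ↦ 2 * (1 - x) * (1 - cos (2 * π * a * x)) / (4 * π ^ 2 * x ^ 2))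
    (F' := fun a x ↦ 2 * (1 - x) * sin (2 * π * a * x) / (2 * π * x))
    (bound := fun _ ↦ 2 * (|a| + 1))
    (Metric.ball_mem_nhds a one_pos)
    (Eventually.of_forall fun b ↦ Measurable.aestronglyMeasurable (by fun_prop))
    (fejerSecondPrimitive_integrand_intervalIntegrable a)
    (Measurable.aestronglyMeasurable (by fun_prop)) ?_ (by simp) ?_).2
  · refine ae_of_all _ fun x hx b hb ↦ ?_
    rw [uIoc_of_le zero_le_one] at hx
    refine (abs_fejerPrimitive_integrand_le b hx).trans ?_
    rw [Metric.mem_ball, Real.dist_eq] at hb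
    have := abs_sub_abs_le_abs_sub b a
    linarith
  · refine ae_of_all _ fun x hx b _ ↦ ?_
    rw [uIoc_of_le zero_le_one] at hx
    have hx0 : x ≠ 0 := hx.1.ne'
    have hlin : HasDerivAt (fun b ↦ 2 * π * b * x) (2 * π * x) b := by
      simpa using ((hasDerivAt_id b).const_mul (2 * π)).mul_const x
    refine (((hlin.cos.const_sub 1).const_mul (2 * (1 - x))).div_const _).congr_deriv ?_
    field_simp
    ring

lemma hasDerivAt_fejerPrimitive (a : ℝ) : HasDerivAt fejerPrimitive (fejerKernel a) a := by
  refine (intervalIntegral.hasDerivAt_integral_of_dominated_loc_of_deriv_le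
    (F := fun a x ↦ 2 * (1 - x) * sin (2 * π * a * x) / (2 * π * x))
    (F' := fun a x ↦ 2 * (1 - x) * cos (2 * π * a * x))
    (bound := fun _ ↦ 2)
    (Metric.ball_mem_nhds a one_pos)
    (Eventually.of_forall fun b ↦ Measurable.aestronglyMeasurable (by fun_prop))
    (intervalIntegrable_zero_one_of_bounded (by fun_prop) _
      fun x ↦ abs_fejerPrimitive_integrand_le a)
    (Measurable.aestronglyMeasurable (by fun_prop)) ?_ (by simp) ?_).2
  · refine ae_of_all _ fun x hx b _ ↦ ?_
    rw [uIoc_of_le zero_le_one] at hx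
    have hc := abs_cos_le_one (2 * π * b * x)
    rw [Real.norm_eq_abs, abs_mul, abs_of_nonneg (by linarith [hx.2])]
    nlinarith [hx.1, hx.2, abs_nonneg (cos (2 * π * b * x))]
  · refine ae_of_all _ fun x hx b _ ↦ ?_
    rw [uIoc_of_le zero_le_one] at hx
    have hx0 : x ≠ 0 := hx.1.ne'
    have hlin : HasDerivAt (fun b ↦ 2 * π * b * x) (2 * π * x) b := by
      simpa using ((hasDerivAt_id b).const_mul (2 * π)).mul_const x
    refine ((hlin.sin.const_mul (2 * (1 - x))).div_const _).congr_deriv ?_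
    field_simp

lemma fejerKernel_eq {a : ℝ} (ha : a ≠ 0) :
    fejerKernel a = 2 * (1 - cos (2 * π * a)) / (2 * π * a) ^ 2 := by
  have hc : 2 * π * a ≠ 0 := by positivity
  rw [fejerKernel]
  set c := 2 * π * a
  have hderiv (x : ℝ) : HasDerivAt
      (fun x ↦ 2 * (1 - x) * (sin (c * x) / c) - 2 * cos (c * x) / c ^ 2)
      (2 * (1 - x) * cos (c * x)) x := by
    have hlin : HasDerivAt (fun x ↦ c * x) c x := by
      simpa using (hasDerivAt_id x).const_mul c
    refine (((((hasDerivAt_id x).const_sub 1).const_mul 2).mul (hlin.sin.div_const c)).sub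
      ((hlin.cos.const_mul 2).div_const (c ^ 2))).congr_deriv ?_
    simp only [id_eq]
    field_simp
    ring
  rw [intervalIntegral.integral_eq_sub_of_hasDerivAt (fun x _ ↦ hderiv x)
    (Continuous.intervalIntegrable (by fun_prop) _ _)]
  simp
  ring

lemma fejerKernel_nonneg (a : ℝ) : 0 ≤ fejerKernel a := by
  rcases eq_or_ne a 0 with rfl | ha
  · refine intervalIntegral.integral_nonneg zero_le_one fun x hx ↦ ?_
    simp only [mul_zero, zero_mul, cos_zero, mul_one]
    linarith [hx.2]
  · rw [fejerKernel_eq ha]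
    have := cos_le_one (2 * π * a)
    exact div_nonneg (by linarith) (sq_nonneg _)

lemma fejerKernel_add_one_le {a : ℝ} (ha : 0 < a) : fejerKernel (a + 1) ≤ fejerKernel a := by
  rw [fejerKernel_eq ha.ne', fejerKernel_eq (by positivity), mul_add, mul_one, cos_add_two_pi]
  have := cos_le_one (2 * π * a)
  have := pi_pos
  gcongr
  all_goals linarith

lemma fejerPrimitive_monotone : Monotone fejerPrimitive :=
  monotone_of_hasDerivAt_nonneg hasDerivAt_fejerPrimitive fejerKernel_nonneg

/-- The unit increment of the second antiderivative of the Fejér kernel. -/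
noncomputable def fejerIncrement (a : ℝ) : ℝ :=
  fejerSecondPrimitive (a + 1) - fejerSecondPrimitive a

lemma hasDerivAt_fejerIncrement (a : ℝ) :
    HasDerivAt fejerIncrement (fejerPrimitive (a + 1) - fejerPrimitive a) a :=
  ((hasDerivAt_fejerSecondPrimitive (a + 1)).comp_add_const a 1).sub
    (hasDerivAt_fejerSecondPrimitive a)

lemma fejerIncrement_concaveOn : ConcaveOn ℝ (Ici 0) fejerIncrement := by
  refine concaveOn_of_hasDerivWithinAt2_nonpos (convex_Ici 0)
    (f'' := fun a ↦ fejerKernel (a + 1) - fejerKernel a)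
    (fun a _ ↦ (hasDerivAt_fejerIncrement a).continuousAt.continuousWithinAt)
    (fun a _ ↦ (hasDerivAt_fejerIncrement a).hasDerivWithinAt)
    (fun a _ ↦ (((hasDerivAt_fejerPrimitive (a + 1)).comp_add_const a 1).sub
      (hasDerivAt_fejerPrimitive a)).hasDerivWithinAt) fun a ha ↦ ?_
  rw [interior_Ici] at ha
  exact sub_nonpos.2 (fejerKernel_add_one_le ha)

lemma fejerIncrement_zero_pos : 0 < fejerIncrement 0 := by
  have h0 : fejerSecondPrimitive 0 = 0 := by simp [fejerSecondPrimitive]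
  rw [fejerIncrement, h0, zero_add, sub_zero]
  refine intervalIntegral.intervalIntegral_pos_of_pos_on
    (fejerSecondPrimitive_integrand_intervalIntegrable 1) (fun x ⟨hx0, hx1⟩ ↦ ?_) one_pos
  have hcos : cos (2 * π * 1 * x) < 1 := by
    refine (cos_le_one _).lt_of_ne fun h ↦ ?_
    have hlt : 2 * π * 1 * x < 2 * π := by nlinarith [pi_pos]
    have hgt : 0 < 2 * π * 1 * x := by positivity
    exact hgt.ne' ((cos_eq_one_iff_of_lt_of_lt (by linarith [pi_pos]) hlt).1 h)
  exact div_pos (mul_pos (by linarith) (by linarith)) (by positivity)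

lemma fejerIncrement_pos {a : ℝ} (ha : 0 ≤ a) : 0 < fejerIncrement a :=
  fejerIncrement_zero_pos.trans_le <| monotone_of_hasDerivAt_nonneg hasDerivAt_fejerIncrement
    (fun b ↦ sub_nonneg.2 (fejerPrimitive_monotone (by linarith))) ha

lemma ghat_eq_fejerIncrement (τ t : ℝ) :
    ghat τ t = fejerIncrement (τ + t) + fejerIncrement (τ - t) := by
  have heven (x : ℝ) :
      gfun τ x * cos (2 * π * x * t) = gfun τ |x| * cos (2 * π * |x| * t) := by
    rcases abs_choice x with h | h
    · rw [h]
    · rw [h]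
      simp [gfun]
  have hI (a : ℝ) := fejerSecondPrimitive_integrand_intervalIntegrable a
  rw [ghat, integral_congr_ae (ae_of_all _ heven),
    integral_comp_abs (f := fun x ↦ gfun τ x * cos (2 * π * x * t)),
    setIntegral_eq_of_subset_of_forall_sdiff_eq_zero measurableSet_Ioi
      (Ioc_subset_Ioi_self : Ioc (0 : ℝ) 1 ⊆ Ioi 0),
    ← intervalIntegral.integral_of_le zero_le_one, ← intervalIntegral.integral_const_mul]
  · simp only [fejerIncrement, fejerSecondPrimitive]
    rw [← intervalIntegral.integral_sub (hI _) (hI _),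
      ← intervalIntegral.integral_sub (hI _) (hI _),
      ← intervalIntegral.integral_add ((hI _).sub (hI _)) ((hI _).sub (hI _))]
    refine intervalIntegral.integral_congr_ae (ae_of_all _ fun x hx ↦ ?_)
    rw [uIoc_of_le zero_le_one] at hx
    rw [gfun, if_neg hx.1.ne', abs_of_pos hx.1, if_pos hx.2]
    have e1 : 2 * π * (τ + t + 1) * x = 2 * π * (τ + 1) * x + 2 * π * x * t := by ring
    have e2 : 2 * π * (τ - t + 1) * x = 2 * π * (τ + 1) * x - 2 * π * x * t := by ring
    have e3 : 2 * π * (τ + t) * x = 2 * π * τ * x + 2 * π * x * t := by ring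
    have e4 : 2 * π * (τ - t) * x = 2 * π * τ * x - 2 * π * x * t := by ring
    rw [e1, e2, e3, e4, cos_add, cos_add, cos_sub, cos_sub]
    ring
  · intro x ⟨hx0, hx1⟩
    have hx : 1 < x := not_le.1 fun h ↦ hx1 ⟨hx0, h⟩
    rw [mem_Ioi] at hx0
    rw [gfun, if_neg hx0.ne', abs_of_pos hx0, if_neg hx.not_ge, zero_mul]

lemma ghat_pos {τ t : ℝ} (ht : t ∈ Icc (-τ) τ) : 0 < ghat τ t := by
  rw [ghat_eq_fejerIncrement]
  exact add_pos (fejerIncrement_pos (by linarith [ht.1])) (fejerIncrement_pos (by linarith [ht.2]))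

lemma ghat_concaveOn (τ : ℝ) : ConcaveOn ℝ (Icc (-τ) τ) (ghat τ) := by
  refine ⟨convex_Icc _ _, fun x hx y hy a b ha hb hab ↦ ?_⟩
  have hadd := fejerIncrement_concaveOn.2 (x := τ + x) (y := τ + y)
    (mem_Ici.2 (by linarith [hx.1])) (mem_Ici.2 (by linarith [hy.1])) ha hb hab
  have hsub := fejerIncrement_concaveOn.2 (x := τ - x) (y := τ - y)
    (mem_Ici.2 (by linarith [hx.2])) (mem_Ici.2 (by linarith [hy.2])) ha hb hab
  simp only [smul_eq_mul, ghat_eq_fejerIncrement] at *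
  have e1 : a * (τ + x) + b * (τ + y) = τ + (a * x + b * y) := by linear_combination τ * hab
  have e2 : a * (τ - x) + b * (τ - y) = τ - (a * x + b * y) := by linear_combination τ * hab
  rw [e1] at hadd
  rw [e2] at hsub
  linarith

lemma ConcaveOn.convexOn_inv_of_pos {s : Set ℝ} {f : ℝ → ℝ} (hf : ConcaveOn ℝ s f)
    (hpos : ∀ x ∈ s, 0 < f x) : ConvexOn ℝ s fun x ↦ (f x)⁻¹ := by
  refine ⟨hf.1, fun x hx y hy a b ha hb hab ↦ ?_⟩
  have hinv : ConvexOn ℝ (Ioi 0) fun x : ℝ ↦ x⁻¹ := by simpa using convexOn_zpow (𝕜 := ℝ) (-1)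
  have hmem := convex_Ioi (0 : ℝ) (hpos x hx) (hpos y hy) ha hb hab
  exact (inv_anti₀ hmem (hf.2 hx hy ha hb hab)).trans
    (hinv.2 (hpos x hx) (hpos y hy) ha hb hab)

theorem ghat_reciprocal_positive_convex (τ : ℝ) (hτ : 0 ≤ τ) :
    (∀ t ∈ Set.Icc (-τ) τ, 0 < ghat τ t) ∧
    ConvexOn ℝ (Set.Icc (-τ) τ) (fun t => (ghat τ t)⁻¹) :=
  ⟨fun _ ↦ ghat_pos, (ghat_concaveOn τ).convexOn_inv_of_pos fun _ ↦ ghat_pos⟩
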